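/- arXiv:2604.20400 — 2 statements merged into one kernel-verified Lean document; each statement's English description precedes it below -/
import Mathlib

section
/- For x ≥ 1 and any integer H ≥ 1, the function ψ(x) = {x} − 1/2 satisfies ψ(x) = −∑_{1 ≤ |h| ≤ H} Φ(h/(H+1)) · e(hx)/(2πih) + R_H(x), where Φ(t) = πt(1−|t|)cot(πt) + |t|, and |R_H(x)| ≤ (1/(2H+2)) · ∑_{|h| ≤ H} (1 − |h|/(H+1)) e(hx). -/
open Finset Real

/-- `N²` times the normalised Fejér kernel, at the angle `θ`. -/
noncomputable def fejerSum (N : ℕ) (θ : ℝ) : ℝ :=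
  ∑ h ∈ range N, 2 * ((N : ℝ) - h) * cos (2 * h * θ) - N

/-- The conjugate Dirichlet kernel at the angle `θ`. -/
noncomputable def sineSum (N : ℕ) (θ : ℝ) : ℝ :=
  ∑ h ∈ range N, sin (2 * h * θ)

theorem sin_mul_sum_cos_two_mul (N : ℕ) (θ : ℝ) :
    sin θ * ∑ h ∈ range N, cos (2 * h * θ) = (sin ((2 * N - 1) * θ) + sin θ) / 2 := by
  induction N with
  | zero => simp
  | succ n ih =>
    rw [sum_range_succ, mul_add, ih]
    have e1 : (2 * ((n + 1 : ℕ) : ℝ) - 1) * θ = 2 * n * θ + θ := by push_cast; ring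
    have e2 : (2 * (n : ℝ) - 1) * θ = 2 * n * θ - θ := by ring
    rw [e1, e2, sin_add, sin_sub]
    ring

theorem sin_sq_mul_fejerSum (N : ℕ) (θ : ℝ) :
    sin θ ^ 2 * fejerSum N θ = sin (N * θ) ^ 2 := by
  induction N with
  | zero => simp [fejerSum]
  | succ n ih =>
    have h1 : fejerSum (n + 1) θ
        = fejerSum n θ + 2 * ∑ h ∈ range (n + 1), cos (2 * h * θ) - 1 := by
      unfold fejerSum
      rw [sum_range_succ, sum_range_succ, mul_add, mul_sum]
      have : ∑ h ∈ range n, 2 * (((n + 1 : ℕ) : ℝ) - h) * cos (2 * h * θ)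
          = ∑ h ∈ range n, 2 * ((n : ℝ) - h) * cos (2 * h * θ)
            + ∑ h ∈ range n, 2 * cos (2 * h * θ) := by
        rw [← sum_add_distrib]
        refine sum_congr rfl fun h _ => ?_
        push_cast; ring
      rw [this]
      push_cast; ring
    have h2 := sin_mul_sum_cos_two_mul (n + 1) θ
    have e1 : (2 * ((n + 1 : ℕ) : ℝ) - 1) * θ = n * θ + (n * θ + θ) := by push_cast; ring
    have e2 : ((n + 1 : ℕ) : ℝ) * θ = n * θ + θ := by push_cast; ring
    rw [e1] at h2
    rw [e2]
    have : sin θ ^ 2 * fejerSum (n + 1) θ = sin θ ^ 2 * fejerSum n θ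
        + 2 * sin θ * (sin θ * ∑ h ∈ range (n + 1), cos (2 * h * θ)) - sin θ ^ 2 := by
      rw [h1]; ring
    rw [this, ih, h2]
    simp only [sin_add, cos_add]
    have hc := sin_sq_add_cos_sq θ
    have hc' := sin_sq_add_cos_sq (n * θ)
    have hc1 : cos θ ^ 2 = 1 - sin θ ^ 2 := by linarith
    have hc2 : cos (n * θ) ^ 2 = 1 - sin (n * θ) ^ 2 := by linarith
    ring_nf
    simp only [hc1, hc2]
    ring

theorem sin_mul_sineSum (N : ℕ) (θ : ℝ) :
    sin θ * sineSum N θ = sin (N * θ) * (sin (N * θ) * cos θ - cos (N * θ) * sin θ) := by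
  induction N with
  | zero => simp [sineSum]
  | succ n ih =>
    unfold sineSum at *
    have e2 : ((n + 1 : ℕ) : ℝ) * θ = n * θ + θ := by push_cast; ring
    have e3 : 2 * (n : ℝ) * θ = 2 * (n * θ) := by ring
    rw [sum_range_succ, mul_add, ih, e2, e3]
    simp only [sin_add, cos_add, sin_two_mul]
    have hc1 : cos θ ^ 2 = 1 - sin θ ^ 2 := by linarith [sin_sq_add_cos_sq θ]
    have hc3 : cos θ ^ 3 = cos θ * (1 - sin θ ^ 2) := by rw [← hc1]; ring
    ring_nf
    simp only [hc1, hc3]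
    ring

theorem sum_exp_eq_zero {N h : ℕ} (h0 : 0 < h) (hN : h < N) :
    ∑ j ∈ range N, Complex.exp (2 * π * Complex.I * h / N) ^ j = 0 ∧
    ∑ j ∈ range N, (j : ℂ) * Complex.exp (2 * π * Complex.I * h / N) ^ j
      = N / (Complex.exp (2 * π * Complex.I * h / N) - 1) := by
  set ω := Complex.exp (2 * π * Complex.I * h / N) with hω
  have hN0 : (N : ℂ) ≠ 0 := by
    exact_mod_cast (by omega : N ≠ 0)
  have h1 : ω ^ N = 1 := by
    rw [hω, ← Complex.exp_nat_mul, Complex.exp_eq_one_iff]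
    exact ⟨h, by push_cast; field_simp⟩
  have h2 : ω ≠ 1 := by
    have := (Complex.isPrimitiveRoot_exp N (by omega)).pow_ne_one_of_pos_of_lt h0.ne' hN
    rw [← Complex.exp_nat_mul] at this
    convert this using 2
    ring
  have h3 : ω - 1 ≠ 0 := sub_ne_zero.2 h2
  have h4 : ∑ j ∈ range N, ω ^ j = 0 := by
    rw [geom_sum_eq h2, h1]; simp
  refine ⟨h4, ?_⟩
  have key : ∀ n : ℕ, (ω - 1) * ∑ j ∈ range n, (j : ℂ) * ω ^ j
      = n * ω ^ n - ω * ∑ j ∈ range n, ω ^ j := by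
    intro n
    induction n with
    | zero => simp
    | succ n ih =>
      rw [sum_range_succ, sum_range_succ, mul_add, ih]
      push_cast; ring
  rw [eq_div_iff h3, mul_comm, key, h1, h4]
  ring

theorem exp_nat_pow_eq (N h j : ℕ) :
    Complex.exp (2 * π * Complex.I * h / N) ^ j
      = ((cos (2 * h * (π * j / N)) : ℝ) : ℂ) + ((sin (2 * h * (π * j / N)) : ℝ) : ℂ) * Complex.I := by
  rw [← Complex.exp_nat_mul]
  push_cast
  rw [← Complex.exp_mul_I]
  congr 1
  ring

theorem sum_cos_eq_zero {N h : ℕ} (h0 : 0 < h) (hN : h < N) :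
    ∑ j ∈ range N, cos (2 * h * (π * j / N)) = 0 := by
  have := congrArg Complex.re (sum_exp_eq_zero h0 hN).1
  simp only [exp_nat_pow_eq, Complex.re_sum] at this
  simpa [-Complex.ofReal_sin, -Complex.ofReal_cos] using this

theorem sum_sin_eq_zero {N h : ℕ} (h0 : 0 < h) (hN : h < N) :
    ∑ j ∈ range N, sin (2 * h * (π * j / N)) = 0 := by
  have := congrArg Complex.im (sum_exp_eq_zero h0 hN).1
  simp only [exp_nat_pow_eq, Complex.im_sum] at this
  simpa [-Complex.ofReal_sin, -Complex.ofReal_cos] using this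

theorem sin_pi_mul_div_pos {N h : ℕ} (h0 : 0 < h) (hN : h < N) : 0 < sin (π * (h / N)) := by
  have hh : (0 : ℝ) < h := by exact_mod_cast h0
  have hN' : (h : ℝ) < N := by exact_mod_cast hN
  have : (h : ℝ) / N < 1 := by rw [div_lt_one (by linarith)]; exact hN'
  have h3 : (0 : ℝ) < h / N := div_pos hh (by linarith)
  apply sin_pos_of_pos_of_lt_pi
  · positivity
  · nlinarith [pi_pos]

theorem inv_exp_sub_one {α : ℝ} (hα : sin α ≠ 0) :
    1 / (Complex.exp (2 * α * Complex.I) - 1)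
      = ((-1 / 2 : ℝ) : ℂ) + ((-(cos α / sin α) / 2 : ℝ) : ℂ) * Complex.I := by
  have hs : (sin α : ℂ) ≠ 0 := by exact_mod_cast hα
  have e : Complex.exp (2 * α * Complex.I) - 1
      = ((2 * sin α : ℝ) : ℂ) * (-(sin α : ℂ) + (cos α : ℂ) * Complex.I) := by
    have : (2 * α * Complex.I : ℂ) = ((2 * α : ℝ) : ℂ) * Complex.I := by push_cast; ring
    rw [this, Complex.exp_mul_I, ← Complex.ofReal_cos, ← Complex.ofReal_sin, cos_two_mul,
      sin_two_mul]
    have hc : (cos α : ℂ) ^ 2 = 1 - (sin α : ℂ) ^ 2 := by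
      exact_mod_cast (by linarith [sin_sq_add_cos_sq α] : cos α ^ 2 = 1 - sin α ^ 2)
    push_cast at hc ⊢
    linear_combination 2 * hc
  have hc : (sin α : ℂ) ^ 2 + (cos α : ℂ) ^ 2 = 1 := by
    exact_mod_cast sin_sq_add_cos_sq α
  have hne : (-(sin α : ℂ) + (cos α : ℂ) * Complex.I) ≠ 0 := by
    intro h0
    apply one_ne_zero (α := ℂ)
    rw [← hc]
    linear_combination (-(sin α : ℂ) - (cos α : ℂ) * Complex.I) * h0 + (cos α : ℂ)^2 * Complex.I_sq
  rw [e, div_eq_iff (mul_ne_zero (by push_cast; exact mul_ne_zero two_ne_zero (by exact_mod_cast hα)) hne)]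
  push_cast at hs hc ⊢
  field_simp
  linear_combination -hc + Complex.cos α ^ 2 * Complex.I_sq

theorem sum_mul_cos_and_sin {N h : ℕ} (h0 : 0 < h) (hN : h < N) :
    ∑ j ∈ range N, (j : ℝ) * cos (2 * h * (π * j / N)) = -N / 2 ∧
    ∑ j ∈ range N, (j : ℝ) * sin (2 * h * (π * j / N))
      = -N / 2 * (cos (π * (h / N)) / sin (π * (h / N))) := by
  have e := (sum_exp_eq_zero h0 hN).2
  have e2 : (2 * π * Complex.I * h / N : ℂ) = 2 * ((π * (h / N) : ℝ) : ℂ) * Complex.I := by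
    push_cast; ring
  rw [div_eq_mul_one_div (N : ℂ)] at e
  nth_rw 2 [e2] at e
  rw [inv_exp_sub_one (sin_pi_mul_div_pos h0 hN).ne'] at e
  simp only [exp_nat_pow_eq] at e
  constructor
  · have := congrArg Complex.re e
    simp [-Complex.ofReal_sin, -Complex.ofReal_cos, -Complex.ofReal_div] at this
    rw [this]; ring
  · have := congrArg Complex.im e
    simp [-Complex.ofReal_sin, -Complex.ofReal_cos, -Complex.ofReal_div] at this
    rw [this]; ring

/-- The function `-u cot u`. -/
noncomputable def negMulCot (u : ℝ) : ℝ := -(u * (cos u / sin u))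

/-- The derivative of `-u cot u`. -/
noncomputable def negMulCotDeriv (u : ℝ) : ℝ := u / sin u ^ 2 - cos u / sin u

theorem hasDerivAt_negMulCot {u : ℝ} (hu : sin u ≠ 0) :
    HasDerivAt negMulCot (negMulCotDeriv u) u := by
  have h := ((hasDerivAt_id u).mul ((hasDerivAt_cos u).div (hasDerivAt_sin u) hu)).neg
  refine h.congr_deriv ?_
  simp only [negMulCotDeriv, id]
  have := sin_sq_add_cos_sq u
  simp only [Pi.div_apply]
  field_simp
  linear_combination u * this

theorem hasDerivAt_negMulCotDeriv {u : ℝ} (hu : sin u ≠ 0) :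
    HasDerivAt negMulCotDeriv (2 * (sin u - u * cos u) / sin u ^ 3) u := by
  have h := ((hasDerivAt_id u).div ((hasDerivAt_sin u).pow 2) (pow_ne_zero 2 hu)).sub
    ((hasDerivAt_cos u).div (hasDerivAt_sin u) hu)
  refine h.congr_deriv ?_
  have := sin_sq_add_cos_sq u
  simp only [Pi.pow_apply, id]
  field_simp
  linear_combination sin u ^ 2 * this

theorem convexOn_negMulCot : ConvexOn ℝ (Set.Ioo 0 π) negMulCot := by
  have hs : ∀ u ∈ Set.Ioo 0 π, sin u ≠ 0 := fun u hu => (sin_pos_of_mem_Ioo hu).ne'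
  have hmono : MonotoneOn negMulCotDeriv (Set.Ioo 0 π) := by
    apply monotoneOn_of_deriv_nonneg (convex_Ioo 0 π)
    · exact fun u hu => (hasDerivAt_negMulCotDeriv (hs u hu)).continuousAt.continuousWithinAt
    · rw [interior_Ioo]
      exact fun u hu =>
        (hasDerivAt_negMulCotDeriv (hs u hu)).differentiableAt.differentiableWithinAt
    · rw [interior_Ioo]
      intro u hu
      rw [(hasDerivAt_negMulCotDeriv (hs u hu)).deriv]
      have hsin := sin_pos_of_mem_Ioo hu
      have : 0 ≤ sin u - u * cos u := by
        rcases lt_or_ge u (π / 2) with h | h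
        · have hc : 0 < cos u := cos_pos_of_mem_Ioo ⟨by linarith [hu.1, pi_pos], h⟩
          have := le_tan hu.1.le h
          rw [tan_eq_sin_div_cos, le_div_iff₀ hc] at this
          linarith
        · have hc : cos u ≤ 0 := cos_nonpos_of_pi_div_two_le_of_le h (by linarith [hu.2, pi_pos])
          nlinarith [hu.1]
      positivity
  apply MonotoneOn.convexOn_of_deriv (convex_Ioo 0 π)
  · exact fun u hu => (hasDerivAt_negMulCot (hs u hu)).continuousAt.continuousWithinAt
  · rw [interior_Ioo]
    exact fun u hu => (hasDerivAt_negMulCot (hs u hu)).differentiableAt.differentiableWithinAt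
  · rw [interior_Ioo]
    exact hmono.congr fun u hu => ((hasDerivAt_negMulCot (hs u hu)).deriv).symm

theorem negMulCot_neg (u : ℝ) : negMulCot (-u) = negMulCot u := by
  simp [negMulCot, div_neg]

theorem negMulCotDeriv_neg (u : ℝ) : negMulCotDeriv (-u) = -negMulCotDeriv u := by
  simp [negMulCotDeriv, div_neg, neg_div]; ring

theorem negMulCotDeriv_nonneg {u : ℝ} (h0 : 0 < u) (h1 : u < π) : 0 ≤ negMulCotDeriv u := by
  have hs := sin_pos_of_pos_of_lt_pi h0 h1
  have h2 := sin_le (x := 2 * u) (by linarith)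
  rw [sin_two_mul] at h2
  have : negMulCotDeriv u = (u - sin u * cos u) / sin u ^ 2 := by
    unfold negMulCotDeriv; field_simp
  rw [this]
  exact div_nonneg (by linarith) (by positivity)

theorem negMulCot_tangent_of_pos {a b : ℝ} (ha : a ∈ Set.Ioo 0 π) (hb : b ∈ Set.Ioo 0 π) :
    negMulCotDeriv a * (b - a) ≤ negMulCot b - negMulCot a := by
  have hd := hasDerivAt_negMulCot (sin_pos_of_mem_Ioo ha).ne'
  rcases lt_trichotomy a b with h | h | h
  · have := convexOn_negMulCot.le_slope_of_hasDerivAt ha hb h hd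
    rwa [slope_def_field, le_div_iff₀ (by linarith)] at this
  · simp [h]
  · have := convexOn_negMulCot.slope_le_of_hasDerivAt hb ha h hd
    rw [slope_def_field, div_le_iff₀ (by linarith)] at this
    linarith

/-- `-u cot u` lies above its tangent lines on the whole of `(-π, π)`. -/
theorem negMulCot_tangent {a b : ℝ} (ha : a ∈ Set.Ioo (-π) π) (ha0 : a ≠ 0)
    (hb : b ∈ Set.Ioo (-π) π) (hb0 : b ≠ 0) :
    negMulCotDeriv a * (b - a) ≤ negMulCot b - negMulCot a := by
  wlog h : 0 < a generalizing a b
  · have h' : 0 < -a := by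
      have := lt_of_le_of_ne (not_lt.1 h) ha0
      linarith
    have := this (a := -a) (b := -b) ⟨by linarith [ha.2], by linarith [ha.1]⟩ (by simpa using ha0)
      ⟨by linarith [hb.2], by linarith [hb.1]⟩ (by simpa using hb0) h'
    rw [negMulCot_neg, negMulCot_neg, negMulCotDeriv_neg] at this
    linarith
  rcases lt_or_gt_of_ne hb0 with hb' | hb'
  · have h1 := negMulCot_tangent_of_pos (a := a) (b := -b) ⟨h, ha.2⟩ ⟨by linarith, by linarith [hb.1]⟩
    rw [negMulCot_neg] at h1
    nlinarith [negMulCotDeriv_nonneg h ha.2]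
  · exact negMulCot_tangent_of_pos ⟨h, ha.2⟩ ⟨hb', hb.2⟩

theorem sin_pi_mul_ne_zero_of_abs_lt_one {u : ℝ} (h1 : -1 < u) (h2 : u < 1) (h0 : u ≠ 0) : sin (π * u) ≠ 0 := by
  intro h
  rw [sin_eq_zero_iff_of_lt_of_lt (by nlinarith [pi_pos]) (by nlinarith [pi_pos])] at h
  exact h0 (by simpa [pi_ne_zero] using h)

theorem sum_negMulCotDeriv_bounds {N : ℕ} (hN : 0 < N) {y : ℝ} (hy0 : 0 < y) (hy1 : y < 1)
    (hy : ∀ j : ℕ, y - j / N ≠ 0) :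
    -(N * (cos (π * y) / sin (π * y))) ≤ ∑ j ∈ range N, negMulCotDeriv (π * (y - j / N)) ∧
    ∑ j ∈ range N, negMulCotDeriv (π * (y - j / N))
      ≤ -(N * (cos (π * y) / sin (π * y))) + π / sin (π * y) ^ 2 := by
  have hN' : (0 : ℝ) < N := by exact_mod_cast hN
  have hpi := pi_pos
  have hmem : ∀ j : ℕ, j ≤ N → π * (y - j / N) ∈ Set.Ioo (-π) π ∧ π * (y - j / N) ≠ 0 := by
    intro j hj
    have h1 : (j : ℝ) / N ≤ 1 := by
      rw [div_le_one hN']; exact_mod_cast hj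
    have h2 : (0 : ℝ) ≤ j / N := by positivity
    exact ⟨⟨by nlinarith, by nlinarith⟩, mul_ne_zero hpi.ne' (hy j)⟩
  have htel : ∑ j ∈ range N,
      (negMulCot (π * (y - j / N)) - negMulCot (π * (y - (j + 1 : ℕ) / N)))
        = -(π * (cos (π * y) / sin (π * y))) := by
    rw [sum_range_sub' (fun j : ℕ => negMulCot (π * (y - j / N)))]
    have : π * (y - (N : ℝ) / N) = π * y - π := by
      rw [div_self hN'.ne']; ring
    rw [this]
    simp only [negMulCot, cos_sub_pi, sin_sub_pi]
    simp [neg_div_neg_eq]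
    ring
  have hend : ∑ j ∈ range N, negMulCotDeriv (π * (y - (j + 1 : ℕ) / N))
      = ∑ j ∈ range N, negMulCotDeriv (π * (y - j / N)) - π / sin (π * y) ^ 2 := by
    have h := sum_range_sub (fun j : ℕ => negMulCotDeriv (π * (y - j / N))) N
    rw [sum_sub_distrib] at h
    have e : π * (y - (N : ℝ) / N) = π * y - π := by
      rw [div_self hN'.ne']; ring
    have e2 : negMulCotDeriv (π * y - π) = negMulCotDeriv (π * y) - π / sin (π * y) ^ 2 := by
      simp only [negMulCotDeriv, cos_sub_pi, sin_sub_pi, neg_div_neg_eq, neg_sq]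
      ring
    rw [e, e2] at h
    simp only [Nat.cast_zero, zero_div, sub_zero] at h
    linarith
  have hstep : ∀ j : ℕ, π * (y - j / N) - π * (y - (j + 1 : ℕ) / N) = π / N := by
    intro j; push_cast; ring
  constructor
  · have h : ∑ j ∈ range N,
        (negMulCot (π * (y - (j : ℕ) / N)) - negMulCot (π * (y - (j + 1 : ℕ) / N)))
        ≤ ∑ j ∈ range N, negMulCotDeriv (π * (y - j / N)) * (π / N) := by
      refine sum_le_sum fun j hj => ?_
      have hj' := mem_range.1 hj
      have := negMulCot_tangent (hmem j hj'.le).1 (hmem j hj'.le).2 (hmem (j + 1) hj').1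
        (hmem (j + 1) hj').2
      rw [← hstep j]
      linarith
    rw [htel, ← sum_mul] at h
    have h2 : (∑ j ∈ range N, negMulCotDeriv (π * (y - j / N))) =
      (∑ j ∈ range N, negMulCotDeriv (π * (y - j / N))) * (π / N) * (N / π) := by field_simp
    have h3 : -(N * (cos (π * y) / sin (π * y))) = -(π * (cos (π * y) / sin (π * y))) * (N / π) := by
      field_simp
    rw [h2, h3]
    exact mul_le_mul_of_nonneg_right h (by positivity)
  · have h : ∑ j ∈ range N, negMulCotDeriv (π * (y - (j + 1 : ℕ) / N)) * (π / N) ≤ ∑ j ∈ range N,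
        (negMulCot (π * (y - (j : ℕ) / N)) - negMulCot (π * (y - (j + 1 : ℕ) / N))) := by
      refine sum_le_sum fun j hj => ?_
      have hj' := mem_range.1 hj
      have := negMulCot_tangent (hmem (j + 1) hj').1 (hmem (j + 1) hj').2 (hmem j hj'.le).1
        (hmem j hj'.le).2
      rwa [hstep j] at this
    rw [htel, ← sum_mul, hend] at h
    rw [← sub_le_iff_le_add]
    have h2 : (∑ j ∈ range N, negMulCotDeriv (π * (y - j / N)) - π / sin (π * y) ^ 2) =
      (∑ j ∈ range N, negMulCotDeriv (π * (y - j / N)) - π / sin (π * y) ^ 2) * (π / N) * (N / π) := by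
      field_simp
    have h3 : -(N * (cos (π * y) / sin (π * y))) = -(π * (cos (π * y) / sin (π * y))) * (N / π) := by
      field_simp
    rw [h2, h3]
    exact mul_le_mul_of_nonneg_right h (by positivity)

theorem sum_cos_shift_eq_zero {N h : ℕ} (h0 : 0 < h) (hN : h < N) (y : ℝ) :
    ∑ j ∈ range N, cos (2 * h * (π * (y - j / N))) = 0 := by
  have e : ∀ j : ℕ, cos (2 * h * (π * (y - j / N)))
      = cos (2 * h * (π * y)) * cos (2 * h * (π * j / N))
        + sin (2 * h * (π * y)) * sin (2 * h * (π * j / N)) := by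
    intro j; rw [← cos_sub]; congr 1; ring
  simp only [e, sum_add_distrib, ← mul_sum, sum_cos_eq_zero h0 hN, sum_sin_eq_zero h0 hN]
  ring

theorem sum_sin_shift_eq_zero {N h : ℕ} (h0 : 0 < h) (hN : h < N) (y : ℝ) :
    ∑ j ∈ range N, sin (2 * h * (π * (y - j / N))) = 0 := by
  have e : ∀ j : ℕ, sin (2 * h * (π * (y - j / N)))
      = sin (2 * h * (π * y)) * cos (2 * h * (π * j / N))
        - cos (2 * h * (π * y)) * sin (2 * h * (π * j / N)) := by
    intro j; rw [← sin_sub]; congr 1; ring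
  simp only [e, sum_sub_distrib, ← mul_sum, sum_cos_eq_zero h0 hN, sum_sin_eq_zero h0 hN]
  ring

theorem sum_mul_cos_shift {N h : ℕ} (h0 : 0 < h) (hN : h < N) (y : ℝ) :
    ∑ j ∈ range N, (j : ℝ) * cos (2 * h * (π * (y - j / N)))
      = -N / 2 * (cos (2 * h * (π * y))
        + cos (π * (h / N)) / sin (π * (h / N)) * sin (2 * h * (π * y))) := by
  have e : ∀ j : ℕ, (j : ℝ) * cos (2 * h * (π * (y - j / N)))
      = cos (2 * h * (π * y)) * (j * cos (2 * h * (π * j / N)))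
        + sin (2 * h * (π * y)) * (j * sin (2 * h * (π * j / N))) := by
    intro j
    have : 2 * h * (π * (y - j / N)) = 2 * h * (π * y) - 2 * h * (π * j / N) := by ring
    rw [this, cos_sub]; ring
  simp only [e, sum_add_distrib, ← mul_sum, (sum_mul_cos_and_sin h0 hN).1,
    (sum_mul_cos_and_sin h0 hN).2]
  ring

theorem sum_sineSum_shift (N : ℕ) (y : ℝ) :
    ∑ j ∈ range N, sineSum N (π * (y - j / N)) = 0 := by
  unfold sineSum
  rw [sum_comm]
  refine sum_eq_zero fun h hh => ?_
  rcases Nat.eq_zero_or_pos h with rfl | h0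
  · simp
  · exact sum_sin_shift_eq_zero h0 (mem_range.1 hh) y

theorem fejerSum_succ (n : ℕ) (θ : ℝ) :
    fejerSum (n + 1) θ
      = ∑ h ∈ range n, 2 * ((n : ℝ) - h) * cos (2 * (h + 1 : ℕ) * θ) + (n + 1 : ℕ) := by
  unfold fejerSum
  rw [sum_range_succ']
  have : ∀ h : ℕ, ((n + 1 : ℕ) : ℝ) - (h + 1 : ℕ) = n - h := by intro h; push_cast; ring
  simp only [this]
  simp; ring

theorem fejerSum_zero_nonneg (N : ℕ) : 0 ≤ fejerSum N 0 := by
  rcases N with _ | n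
  · simp [fejerSum]
  · rw [fejerSum_succ]
    refine add_nonneg (sum_nonneg fun h hh => ?_) (by positivity)
    simpa using (mem_range.1 hh).le

theorem sum_fejerSum_shift (N : ℕ) (y : ℝ) :
    ∑ j ∈ range N, fejerSum N (π * (y - j / N)) = (N : ℝ) ^ 2 := by
  rcases N with _ | n
  · simp
  · simp only [fejerSum_succ]
    rw [sum_add_distrib, sum_comm]
    have : ∀ h ∈ range n, ∑ j ∈ range (n + 1),
        2 * ((n : ℝ) - h) * cos (2 * (h + 1 : ℕ) * (π * (y - j / (n + 1 : ℕ)))) = 0 := by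
      intro h hh
      rw [← mul_sum, sum_cos_shift_eq_zero (by omega) (by have := mem_range.1 hh; omega), mul_zero]
    rw [sum_eq_zero this]
    simp; ring

/-- The cotangent part of the Vaaler polynomial, scaled by `N²`. -/
noncomputable def cotSum (N : ℕ) (θ : ℝ) : ℝ :=
  ∑ h ∈ range N, ((N : ℝ) - h) * (cos (π * (h / N)) / sin (π * (h / N))) * sin (2 * h * θ)

theorem sum_mul_fejerSum_shift (N : ℕ) (y : ℝ) :
    ∑ j ∈ range N, (j : ℝ) * fejerSum N (π * (y - j / N))
      = (N : ℝ) ^ 3 / 2 - N / 2 * fejerSum N (π * y) - N * cotSum N (π * y) := by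
  rcases N with _ | n
  · simp
  · have hj : ∑ j ∈ range (n + 1), (j : ℝ) = (n + 1 : ℕ) * n / 2 := by
      have := Finset.sum_range_id_mul_two (n + 1)
      rw [Nat.add_sub_cancel] at this
      have h2 := congrArg (Nat.cast (R := ℝ)) this
      push_cast at h2 ⊢
      linarith
    have hcot : cotSum (n + 1) (π * y) = ∑ h ∈ range n, ((n : ℝ) - h) *
        (cos (π * ((h + 1 : ℕ) / (n + 1 : ℕ))) / sin (π * ((h + 1 : ℕ) / (n + 1 : ℕ)))) *
          sin (2 * (h + 1 : ℕ) * (π * y)) := by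
      unfold cotSum
      rw [sum_range_succ']
      have : ∀ h : ℕ, ((n + 1 : ℕ) : ℝ) - (h + 1 : ℕ) = n - h := by intro h; push_cast; ring
      simp only [this]
      simp
    have hmain : ∀ h ∈ range n, ∑ j ∈ range (n + 1),
        (j : ℝ) * (2 * ((n : ℝ) - h) * cos (2 * (h + 1 : ℕ) * (π * (y - j / (n + 1 : ℕ)))))
        = -((n + 1 : ℕ) / 2 * (2 * ((n : ℝ) - h) * cos (2 * (h + 1 : ℕ) * (π * y))))
          - (n + 1 : ℕ) * (((n : ℝ) - h) *
        (cos (π * ((h + 1 : ℕ) / (n + 1 : ℕ))) / sin (π * ((h + 1 : ℕ) / (n + 1 : ℕ)))) *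
          sin (2 * (h + 1 : ℕ) * (π * y))) := by
      intro h hh
      have e := sum_mul_cos_shift (N := n + 1) (h := h + 1) (by omega)
        (by have := mem_range.1 hh; omega) y
      have : ∀ j : ℕ,
        (j : ℝ) * (2 * ((n : ℝ) - h) * cos (2 * (h + 1 : ℕ) * (π * (y - j / (n + 1 : ℕ)))))
        = 2 * ((n : ℝ) - h) * (j * cos (2 * (h + 1 : ℕ) * (π * (y - j / (n + 1 : ℕ))))) := by
        intro j; ring
      simp only [this]
      rw [← mul_sum, e]
      ring
    rw [hcot]
    simp only [fejerSum_succ, mul_add]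
    rw [sum_add_distrib]
    simp only [mul_sum]
    rw [sum_comm, sum_congr rfl hmain, sum_sub_distrib, sum_neg_distrib, ← sum_mul, hj]
    push_cast
    ring

theorem vaaler_sum_bounds {N : ℕ} (hN : 0 < N) {y : ℝ} (hy0 : 0 ≤ y) (hy1 : y < 1) :
    0 ≤ ∑ j ∈ range N, π * (y - j / N) * fejerSum N (π * (y - j / N)) + N * sineSum N (π * y) ∧
    ∑ j ∈ range N, π * (y - j / N) * fejerSum N (π * (y - j / N)) + N * sineSum N (π * y)
      ≤ π * fejerSum N (π * y) := by
  have hN' : (0 : ℝ) < N := by exact_mod_cast hN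
  have hshift : ∀ j : ℕ, N * (π * (y - j / N)) = N * (π * y) - j * π := by
    intro j; field_simp
  have hmem : ∀ j ∈ range N, -1 < y - j / N ∧ y - j / N < 1 := by
    intro j hj
    have h1 : (j : ℝ) / N < 1 := by
      rw [div_lt_one hN']; exact_mod_cast mem_range.1 hj
    have h2 : (0 : ℝ) ≤ j / N := by positivity
    constructor <;> linarith
  by_cases hs : sin (N * (π * y)) = 0
  · have hzero : ∀ j ∈ range N, π * (y - j / N) * fejerSum N (π * (y - j / N)) = 0 := by
      intro j hj
      by_cases hz : y - j / N = 0
      · rw [hz]; simp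
      · have h1 := sin_pi_mul_ne_zero_of_abs_lt_one (hmem j hj).1 (hmem j hj).2 hz
        have h2 := sin_sq_mul_fejerSum N (π * (y - j / N))
        rw [hshift, sin_sub_nat_mul_pi, hs] at h2
        have h3 : fejerSum N (π * (y - j / N)) = 0 := by simpa [h1] using h2
        rw [h3, mul_zero]
    rw [sum_eq_zero hzero]
    rcases hy0.eq_or_lt with rfl | hy0
    · simp [sineSum]
      exact mul_nonneg pi_pos.le (fejerSum_zero_nonneg N)
    · have h1 := sin_pi_mul_ne_zero_of_abs_lt_one (by linarith) hy1 hy0.ne'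
      have h2 := sin_sq_mul_fejerSum N (π * y)
      have h3 := sin_mul_sineSum N (π * y)
      rw [hs] at h2 h3
      have h4 : sineSum N (π * y) = 0 := by simpa [h1] using h3
      have h5 : fejerSum N (π * y) = 0 := by simpa [h1] using h2
      simp [h4, h5]
  · have hy : ∀ j : ℕ, y - j / N ≠ 0 := by
      intro j hj
      apply hs
      have := hshift j
      rw [hj] at this
      rw [show N * (π * y) = j * π by linarith]
      exact sin_nat_mul_pi j
    have hy0' : 0 < y := lt_of_le_of_ne hy0 fun h => hs (by rw [← h]; simp)
    have hsy := sin_pi_mul_ne_zero_of_abs_lt_one (by linarith) hy1 hy0'.ne'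
    obtain ⟨hlow, hupp⟩ := sum_negMulCotDeriv_bounds hN hy0' hy1 hy
    set s := sin (N * (π * y)) with hs_def
    set c := cos (N * (π * y)) with hc_def
    have hs2 : 0 < s ^ 2 := by positivity
    have hF : ∀ u, sin u ≠ 0 → fejerSum N u = sin (N * u) ^ 2 / sin u ^ 2 := by
      intro u hu
      rw [eq_div_iff (pow_ne_zero 2 hu), mul_comm, sin_sq_mul_fejerSum]
    have hC : ∀ u, sin u ≠ 0 →
        sin (N * u) ^ 2 * (cos u / sin u) = sineSum N u + sin (N * u) * cos (N * u) := by
      intro u hu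
      rw [← mul_right_inj' hu, mul_add, sin_mul_sineSum]
      field_simp
      ring
    have hterm : ∀ j ∈ range N, s ^ 2 * negMulCotDeriv (π * (y - j / N))
        = π * (y - j / N) * fejerSum N (π * (y - j / N))
          - (sineSum N (π * (y - j / N)) + s * c) := by
      intro j hj
      have hu := sin_pi_mul_ne_zero_of_abs_lt_one (hmem j hj).1 (hmem j hj).2 (hy j)
      have h1 := hF _ hu
      have h2 := hC _ hu
      have hsq : (((-1 : ℝ)) ^ j) ^ 2 = 1 := by rw [← pow_mul, mul_comm, pow_mul]; simp
      have e1 : sin (N * (π * (y - j / N))) ^ 2 = s ^ 2 := by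
        rw [hshift, sin_sub_nat_mul_pi, mul_pow, hsq, one_mul]
      have e2 : sin (N * (π * (y - j / N))) * cos (N * (π * (y - j / N))) = s * c := by
        rw [hshift, sin_sub_nat_mul_pi, cos_sub_nat_mul_pi]
        linear_combination s * c * hsq
      rw [e1] at h1 h2
      rw [e2] at h2
      rw [← h2, h1, negMulCotDeriv]
      ring
    have hsum : s ^ 2 * ∑ j ∈ range N, negMulCotDeriv (π * (y - j / N))
        = ∑ j ∈ range N, π * (y - j / N) * fejerSum N (π * (y - j / N)) - N * (s * c) := by
      rw [mul_sum, sum_congr rfl hterm, sum_sub_distrib, sum_add_distrib, sum_sineSum_shift]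
      simp
    have hlow' := mul_le_mul_of_nonneg_left hlow hs2.le
    have hupp' := mul_le_mul_of_nonneg_left hupp hs2.le
    have hFy := hF _ hsy
    have hCy := hC _ hsy
    rw [← hs_def] at hFy hCy
    rw [← hc_def] at hCy
    have e3 : s ^ 2 * -(N * (cos (π * y) / sin (π * y))) = -N * (sineSum N (π * y) + s * c) := by
      rw [← hCy]; ring
    have e4 : s ^ 2 * (π / sin (π * y) ^ 2) = π * fejerSum N (π * y) := by
      rw [hFy]; ring
    rw [hsum, e3] at hlow'
    rw [hsum, mul_add, e3, e4] at hupp'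
    constructor <;> linarith

theorem abs_sawtooth_sub_le {N : ℕ} (hN : 0 < N) {y : ℝ} (hy0 : 0 ≤ y) (hy1 : y < 1) :
    |y - 1 / 2 + cotSum N (π * y) / N ^ 2 + sineSum N (π * y) / (π * N)|
      ≤ fejerSum N (π * y) / (2 * N ^ 2) := by
  have hN' : (0 : ℝ) < N := by exact_mod_cast hN
  have hpi := pi_pos
  obtain ⟨h1, h2⟩ := vaaler_sum_bounds hN hy0 hy1
  have e : ∑ j ∈ range N, π * (y - j / N) * fejerSum N (π * (y - j / N))
      = π * y * N ^ 2 - π / N * ((N : ℝ) ^ 3 / 2 - N / 2 * fejerSum N (π * y)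
        - N * cotSum N (π * y)) := by
    rw [← sum_fejerSum_shift N y, ← sum_mul_fejerSum_shift, mul_sum, mul_sum, ← sum_sub_distrib]
    refine sum_congr rfl fun j _ => ?_
    ring
  have e2 : ∑ j ∈ range N, π * (y - j / N) * fejerSum N (π * (y - j / N)) + N * sineSum N (π * y)
      = π * N ^ 2 * ((y - 1 / 2 + cotSum N (π * y) / N ^ 2 + sineSum N (π * y) / (π * N))
        + fejerSum N (π * y) / (2 * N ^ 2)) := by
    rw [e]; field_simp; ring
  have e3 : π * fejerSum N (π * y) = π * N ^ 2 * (2 * (fejerSum N (π * y) / (2 * N ^ 2))) := by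
    field_simp
  rw [e2] at h1 h2
  rw [e3] at h2
  have hp : 0 < π * (N : ℝ) ^ 2 := by positivity
  have h1' := nonneg_of_mul_nonneg_right h1 hp
  have h2' := le_of_mul_le_mul_left h2 hp
  rw [abs_le]
  constructor <;> linarith

theorem sum_Icc_neg_eq (f : ℤ → ℂ) (H : ℕ) :
    ∑ h ∈ Icc (-(H : ℤ)) H, f h = ∑ h ∈ range (H + 1), (f h + f (-h)) - f 0 := by
  induction H with
  | zero => simp
  | succ n ih =>
    have : Icc (-((n + 1 : ℕ) : ℤ)) (n + 1 : ℕ)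
        = insert ((n : ℤ) + 1) (insert (-((n : ℤ) + 1)) (Icc (-(n : ℤ)) n)) := by
      ext a; simp only [mem_Icc, mem_insert]; push_cast; omega
    rw [this, sum_insert, sum_insert, ih, sum_range_succ _ (n + 1)]
    · push_cast; ring
    · simp
    · simp; omega

theorem exp_fract_eq (x : ℝ) (h : ℤ) :
    Complex.exp (2 * π * Complex.I * (h * x))
      = ((cos (2 * h * (π * Int.fract x)) : ℝ) : ℂ)
        + ((sin (2 * h * (π * Int.fract x)) : ℝ) : ℂ) * Complex.I := by
  push_cast
  rw [← Complex.exp_mul_I, Complex.exp_eq_exp_iff_exists_int]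
  refine ⟨h * ⌊x⌋, ?_⟩
  have : (x : ℂ) = (⌊x⌋ : ℂ) + (Int.fract x : ℝ) := by
    exact_mod_cast (Int.floor_add_fract x).symm
  rw [this]
  push_cast; ring

theorem vaaler_approximation (x : ℝ) (hx : 1 ≤ x) (H : ℕ) (hH : 1 ≤ H) :
    ‖((Int.fract x - 1 / 2 : ℝ) : ℂ) +
        ∑ h ∈ (Finset.Icc (-(H : ℤ)) H).filter (· ≠ 0),
          ((Real.pi * ((h : ℝ) / (H + 1)) * (1 - |(h : ℝ) / (H + 1)|) *
              (Real.cos (Real.pi * ((h : ℝ) / (H + 1))) /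
                Real.sin (Real.pi * ((h : ℝ) / (H + 1)))) +
              |(h : ℝ) / (H + 1)| : ℝ) : ℂ) *
            Complex.exp (2 * Real.pi * Complex.I * (h * x)) /
              (2 * Real.pi * Complex.I * h)‖ ≤
      1 / (2 * H + 2) *
        ‖∑ h ∈ Finset.Icc (-(H : ℤ)) H,
            ((1 - |(h : ℝ)| / (H + 1) : ℝ) : ℂ) *
              Complex.exp (2 * Real.pi * Complex.I * (h * x))‖ := by
  have hN : (0 : ℝ) < H + 1 := by positivity
  set y := Int.fract x with hy
  have hkernel : ∑ h ∈ Finset.Icc (-(H : ℤ)) H, ((1 - |(h : ℝ)| / (H + 1) : ℝ) : ℂ) *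
      Complex.exp (2 * Real.pi * Complex.I * (h * x))
      = ((fejerSum (H + 1) (π * y) / (H + 1) : ℝ) : ℂ) := by
    rw [sum_Icc_neg_eq, fejerSum, sub_div, sum_div]
    simp only [exp_fract_eq, ← hy]
    push_cast
    congr 1
    · refine sum_congr rfl fun h _ => ?_
      have : (H + 1 : ℂ) ≠ 0 := by exact_mod_cast hN.ne'
      simp [-Complex.ofReal_sin, -Complex.ofReal_cos]
      field_simp
      ring
    · have : (H + 1 : ℂ) ≠ 0 := by exact_mod_cast hN.ne'
      simp [this]
  have hpoly : ∑ h ∈ (Finset.Icc (-(H : ℤ)) H).filter (· ≠ 0),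
          ((Real.pi * ((h : ℝ) / (H + 1)) * (1 - |(h : ℝ) / (H + 1)|) *
              (Real.cos (Real.pi * ((h : ℝ) / (H + 1))) /
                Real.sin (Real.pi * ((h : ℝ) / (H + 1)))) +
              |(h : ℝ) / (H + 1)| : ℝ) : ℂ) *
            Complex.exp (2 * Real.pi * Complex.I * (h * x)) /
              (2 * Real.pi * Complex.I * h)
      = ((cotSum (H + 1) (π * y) / (H + 1) ^ 2
          + sineSum (H + 1) (π * y) / (π * (H + 1)) : ℝ) : ℂ) := by
    rw [sum_filter_of_ne (by
      intro h _ hne h0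
      apply hne
      simp [h0]), sum_Icc_neg_eq, cotSum, sineSum, sum_div, sum_div, ← sum_add_distrib]
    simp only [exp_fract_eq, ← hy]
    rw [Complex.ofReal_sum]
    simp only [Int.cast_zero, mul_zero, div_zero, sub_zero]
    refine sum_congr rfl fun h _ => ?_
    have hH0 : (H + 1 : ℂ) ≠ 0 := by exact_mod_cast hN.ne'
    have hpi : (π : ℂ) ≠ 0 := by exact_mod_cast pi_ne_zero
    rcases Nat.eq_zero_or_pos h with rfl | h0
    · simp
    have hh : (h : ℂ) ≠ 0 := by exact_mod_cast h0.ne'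
    have habs : |(h : ℝ) / (H + 1)| = h / (H + 1) := abs_of_nonneg (by positivity)
    have hneg : ((-(h : ℤ) : ℤ) : ℝ) / (H + 1) = -(h / (H + 1)) := by push_cast; ring
    have hneg' : (2 * ((-(h : ℤ) : ℤ) : ℝ) * (π * y)) = -(2 * h * (π * y)) := by push_cast; ring
    rw [hneg, hneg', abs_neg, mul_neg, cos_neg, sin_neg, cos_neg, sin_neg, Int.cast_natCast, habs]
    generalize cos (2 * h * (π * y)) = C
    generalize sin (2 * h * (π * y)) = S
    push_cast
    rw [div_neg]
    generalize Complex.cos (π * (h / (H + 1))) / Complex.sin (π * (h / (H + 1))) = T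
    field_simp
    ring
  have hmain := abs_sawtooth_sub_le (Nat.succ_pos H) (Int.fract_nonneg x) (Int.fract_lt_one x)
  rw [← hy] at hmain
  rw [hkernel, hpoly, ← Complex.ofReal_add, Complex.norm_real, Complex.norm_real, norm_eq_abs,
    norm_eq_abs, ← add_assoc]
  push_cast at hmain
  refine hmain.trans ?_
  have := le_abs_self (fejerSum (H + 1) (π * y) / (H + 1))
  calc fejerSum (H + 1) (π * y) / (2 * (H + 1) ^ 2)
      = 1 / (2 * H + 2) * (fejerSum (H + 1) (π * y) / (H + 1)) := by field_simp
    _ ≤ _ := by gcongr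
end

section
/- Let K, L be positive integers, X ≥ 1 real, and let a(k), b(l) be complex numbers of modulus at most 1, and u(k), v(l) real numbers with |u(k)| ≪ 1, |v(l)| ≪ 1. Define 𝓑₁ = #{(k₁,k₂) : 1 ≤ k₁,k₂ ≤ K, |u(k₁) − u(k₂)| ≤ 1/X} and 𝓑₂ = #{(l₁,l₂) : 1 ≤ l₁,l₂ ≤ L, |v(l₁) − v(l₂)| ≤ 1/X}. Then |∑_{k=1}^{K} ∑_{l=1}^{L} a(k) b(l) e(X u(k) v(l))| ≪ X^{1/2} 𝓑₁^{1/2} 𝓑₂^{1/2}. -/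
open Finset Real

/-- Twisting a bilinear form by `exp (z * x k * y l)`, with `x` and `y` bounded by one, increases
its norm by a factor of at most `exp ‖z‖`. -/
lemma norm_bilinear_mul_exp_le {ι κ : Type*} (s : Finset ι) (t : Finset κ) (φ : ι → κ → ℂ) (D : ℝ)
    (h : ∀ (a : ι → ℂ) (b : κ → ℂ), (∀ k ∈ s, ‖a k‖ ≤ 1) → (∀ l ∈ t, ‖b l‖ ≤ 1) →
      ‖∑ k ∈ s, ∑ l ∈ t, a k * b l * φ k l‖ ≤ D)
    (z : ℂ) (x : ι → ℂ) (y : κ → ℂ) (hx : ∀ k ∈ s, ‖x k‖ ≤ 1) (hy : ∀ l ∈ t, ‖y l‖ ≤ 1)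
    (a : ι → ℂ) (b : κ → ℂ) (ha : ∀ k ∈ s, ‖a k‖ ≤ 1) (hb : ∀ l ∈ t, ‖b l‖ ≤ 1) :
    ‖∑ k ∈ s, ∑ l ∈ t, a k * b l * (φ k l * Complex.exp (z * x k * y l))‖ ≤
      Real.exp ‖z‖ * D := by
  have hexp : HasSum (fun n : ℕ => ‖z‖ ^ n / n.factorial * D) (Real.exp ‖z‖ * D) := by
    rw [Real.exp_eq_exp_ℝ]
    exact (NormedSpace.expSeries_div_hasSum_exp ‖z‖).mul_right D
  have hsum : HasSum (fun n : ℕ => z ^ n / n.factorial *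
      ∑ k ∈ s, ∑ l ∈ t, (a k * x k ^ n) * (b l * y l ^ n) * φ k l)
      (∑ k ∈ s, ∑ l ∈ t, a k * b l * (φ k l * Complex.exp (z * x k * y l))) := by
    simp_rw [mul_sum]
    refine hasSum_sum fun k _ => hasSum_sum fun l _ => ?_
    have := ((NormedSpace.expSeries_div_hasSum_exp (z * x k * y l)).mul_left (φ k l)).mul_left
      (a k * b l)
    rw [← Complex.exp_eq_exp_ℂ] at this
    exact this.congr_fun fun n => by ring
  refine hsum.norm_le_of_bounded hexp fun n => ?_
  rw [norm_mul, norm_div, norm_pow, Complex.norm_natCast]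
  refine mul_le_mul_of_nonneg_left (h _ _ (fun k hk => ?_) fun l hl => ?_) (by positivity)
  · rw [norm_mul, norm_pow]
    exact mul_le_one₀ (ha k hk) (by positivity) (pow_le_one₀ (norm_nonneg _) (hx k hk))
  · rw [norm_mul, norm_pow]
    exact mul_le_one₀ (hb l hl) (by positivity) (pow_le_one₀ (norm_nonneg _) (hy l hl))

lemma sum_card_fiber_sq {ι α : Type*} [Fintype α] [DecidableEq α] (s : Finset ι) (i : ι → α) :
    ∑ x, (#{k ∈ s | i k = x}) ^ 2 = #{p ∈ s ×ˢ s | i p.1 = i p.2} := by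
  rw [card_eq_sum_card_fiberwise (f := fun p => i p.1) (t := univ) (by simp)]
  refine sum_congr rfl fun x _ => ?_
  rw [sq, ← card_product]
  congr 1
  ext p
  simp only [mem_product, mem_filter]
  constructor
  · rintro ⟨⟨h1, h2⟩, h3, h4⟩
    exact ⟨⟨⟨h1, h3⟩, h2.trans h4.symm⟩, h2⟩
  · rintro ⟨⟨⟨h1, h2⟩, h3⟩, h4⟩
    exact ⟨⟨h1, h4⟩, h2, h3.symm.trans h4⟩

lemma sum_norm_sq_stdAddChar_le {κ : Type*} (Q : ℕ) [NeZero Q] (t : Finset κ) (j : κ → ZMod Q)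
    (b : κ → ℂ) (hb : ∀ l ∈ t, ‖b l‖ ≤ 1) :
    ∑ x : ZMod Q, ‖∑ l ∈ t, b l * ZMod.stdAddChar (x * j l)‖ ^ 2 ≤
      Q * #{p ∈ t ×ˢ t | j p.1 = j p.2} := by
  have key : ((∑ x : ZMod Q, ‖∑ l ∈ t, b l * ZMod.stdAddChar (x * j l)‖ ^ 2 : ℝ) : ℂ) =
      ∑ p ∈ t ×ˢ t with j p.1 = j p.2, Q * (b p.1 * starRingEnd ℂ (b p.2)) := by
    push_cast
    simp_rw [← Complex.mul_conj', map_sum, sum_mul_sum, ← sum_product']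
    rw [sum_product_right, sum_filter]
    refine sum_congr rfl fun p _ => ?_
    have hx (x : ZMod Q) : b p.1 * ZMod.stdAddChar (x * j p.1) *
        starRingEnd ℂ (b p.2 * ZMod.stdAddChar (x * j p.2)) =
        b p.1 * starRingEnd ℂ (b p.2) * ZMod.stdAddChar (x * (j p.1 - j p.2)) := by
      rw [map_mul (starRingEnd ℂ), ← AddChar.map_neg_eq_conj, mul_sub, sub_eq_add_neg, AddChar.map_add_eq_mul]
      ring
    simp_rw [hx, ← mul_sum]
    rw [AddChar.sum_mulShift _ (ZMod.isPrimitive_stdAddChar Q)]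
    simp only [sub_eq_zero, ZMod.card]
    split_ifs <;> simp [mul_comm]
  have hn : (0 : ℝ) ≤ ∑ x : ZMod Q, ‖∑ l ∈ t, b l * ZMod.stdAddChar (x * j l)‖ ^ 2 := by positivity
  rw [← Complex.norm_of_nonneg hn, key, mul_comm, ← nsmul_eq_mul]
  refine (norm_sum_le_of_le _ fun p hp => ?_).trans_eq (sum_const _)
  simp only [mem_filter, mem_product] at hp
  rw [norm_mul, norm_mul, RCLike.norm_conj, Complex.norm_natCast]
  exact mul_le_of_le_one_right (by positivity)
    (mul_le_one₀ (hb _ hp.1.1) (norm_nonneg _) (hb _ hp.1.2))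

/-- The double large sieve for the additive characters modulo `Q`. -/
lemma norm_sum_stdAddChar_sq_le {ι κ : Type*} (Q : ℕ) [NeZero Q] (s : Finset ι) (t : Finset κ)
    (i : ι → ZMod Q) (j : κ → ZMod Q) (a : ι → ℂ) (b : κ → ℂ)
    (ha : ∀ k ∈ s, ‖a k‖ ≤ 1) (hb : ∀ l ∈ t, ‖b l‖ ≤ 1) :
    ‖∑ k ∈ s, ∑ l ∈ t, a k * b l * ZMod.stdAddChar (i k * j l)‖ ^ 2 ≤
      Q * #{p ∈ s ×ˢ s | i p.1 = i p.2} * #{p ∈ t ×ˢ t | j p.1 = j p.2} := by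
  set B : ZMod Q → ℂ := fun x => ∑ l ∈ t, b l * ZMod.stdAddChar (x * j l)
  have h1 : ‖∑ k ∈ s, ∑ l ∈ t, a k * b l * ZMod.stdAddChar (i k * j l)‖ ≤
      ∑ x, (#{k ∈ s | i k = x} : ℝ) * ‖B x‖ := by
    have : ∑ x, (#{k ∈ s | i k = x} : ℝ) * ‖B x‖ = ∑ k ∈ s, ‖B (i k)‖ := by
      rw [← sum_fiberwise s i]
      refine sum_congr rfl fun x _ => ?_
      rw [← nsmul_eq_mul, ← sum_const]
      refine sum_congr rfl fun k hk => ?_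
      rw [(mem_filter.1 hk).2]
    rw [this]
    refine norm_sum_le_of_le _ fun k hk => ?_
    simp_rw [mul_assoc, ← mul_sum]
    rw [norm_mul]
    exact mul_le_of_le_one_left (norm_nonneg _) (ha k hk)
  calc _ ≤ (∑ x, (#{k ∈ s | i k = x} : ℝ) * ‖B x‖) ^ 2 := by gcongr
    _ ≤ (∑ x, (#{k ∈ s | i k = x} : ℝ) ^ 2) * ∑ x, ‖B x‖ ^ 2 := sum_mul_sq_le_sq_mul_sq _ _ _
    _ ≤ #{p ∈ s ×ˢ s | i p.1 = i p.2} * (Q * #{p ∈ t ×ˢ t | j p.1 = j p.2}) := by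
      refine mul_le_mul (le_of_eq ?_) (sum_norm_sq_stdAddChar_le Q t j b hb)
        (by positivity) (by positivity)
      exact_mod_cast sum_card_fiber_sq s i
    _ = _ := by ring

/-- Points whose scaled integer parts agree modulo a large enough modulus are close. -/
lemma card_floor_congr_le {ι : Type*} (s : Finset ι) (u : ι → ℝ) (W X M : ℝ) (Q : ℕ)
    (hX : 0 < X) (hXM : X ≤ M) (hQ : 2 * W * M + 1 < Q) (hu : ∀ k ∈ s, |u k| ≤ W) :
    #{p ∈ s ×ˢ s | ((⌊M * u p.1⌋ : ℤ) : ZMod Q) = ((⌊M * u p.2⌋ : ℤ) : ZMod Q)} ≤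
      #{p ∈ s ×ˢ s | |u p.1 - u p.2| ≤ 1 / X} := by
  refine card_le_card fun p hp => ?_
  simp only [mem_filter, mem_product] at hp ⊢
  obtain ⟨⟨h1, h2⟩, h3⟩ := hp
  refine ⟨⟨h1, h2⟩, ?_⟩
  have hM : 0 < M := hX.trans_le hXM
  have b1 := abs_le.1 (hu _ h1)
  have b2 := abs_le.1 (hu _ h2)
  have f1 := Int.floor_le (M * u p.1)
  have f2 := Int.lt_floor_add_one (M * u p.1)
  have f3 := Int.floor_le (M * u p.2)
  have f4 := Int.lt_floor_add_one (M * u p.2)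
  have c1 := mul_le_mul_of_nonneg_left b1.1 hM.le
  have c2 := mul_le_mul_of_nonneg_left b1.2 hM.le
  have c3 := mul_le_mul_of_nonneg_left b2.1 hM.le
  have c4 := mul_le_mul_of_nonneg_left b2.2 hM.le
  have heq : ⌊M * u p.1⌋ = ⌊M * u p.2⌋ := by
    have hd := (ZMod.intCast_eq_intCast_iff_dvd_sub _ _ _).1 h3
    have : |⌊M * u p.2⌋ - ⌊M * u p.1⌋| < (Q : ℤ) := by
      have : |(⌊M * u p.2⌋ : ℝ) - ⌊M * u p.1⌋| < Q := by
        rw [abs_lt]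
        constructor <;> nlinarith
      exact_mod_cast this
    have := Int.eq_zero_of_abs_lt_dvd hd this
    omega
  rw [heq] at f1 f2
  have hlt : |M * (u p.1 - u p.2)| ≤ 1 := by
    rw [abs_le]
    constructor <;> linarith
  rw [abs_mul, abs_of_pos hM] at hlt
  rw [le_div_iff₀ hX, mul_comm]
  exact (mul_le_mul_of_nonneg_right hXM (abs_nonneg _)).trans hlt

theorem double_large_sieve (U V : ℝ) (hU : 0 < U) (hV : 0 < V) :
    ∃ C > 0, ∀ (K L : ℕ), 0 < K → 0 < L → ∀ X : ℝ, 1 ≤ X →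
      ∀ (a : ℕ → ℂ) (b : ℕ → ℂ) (u v : ℕ → ℝ),
      (∀ k, ‖a k‖ ≤ 1) → (∀ l, ‖b l‖ ≤ 1) →
      (∀ k ∈ Finset.Icc 1 K, |u k| ≤ U) → (∀ l ∈ Finset.Icc 1 L, |v l| ≤ V) →
      ‖∑ k ∈ Finset.Icc 1 K, ∑ l ∈ Finset.Icc 1 L, a k * b l *
          Complex.exp (2 * Real.pi * Complex.I * ((X * u k * v l : ℝ) : ℂ))‖ ≤
        C * X ^ ((1 : ℝ) / 2) *
          ((((Finset.Icc 1 K ×ˢ Finset.Icc 1 K).filter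
              (fun p => |u p.1 - u p.2| ≤ 1 / X)).card : ℝ) ^ ((1 : ℝ) / 2)) *
          ((((Finset.Icc 1 L ×ˢ Finset.Icc 1 L).filter
              (fun p => |v p.1 - v p.2| ≤ 1 / X)).card : ℝ) ^ ((1 : ℝ) / 2)) := by
  set W := U + V with hW
  set z₁ : ℂ := 2 * Real.pi * Complex.I * ((U + 1 : ℝ) : ℂ) with hz₁
  set z₂ : ℂ := 2 * Real.pi * Complex.I * (V : ℂ) with hz₂
  refine ⟨Real.exp ‖z₂‖ * (Real.exp ‖z₁‖ * √((2 * W + 1) ^ 2 + 1)), by positivity, ?_⟩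
  intro K L _ _ X hX a b u v ha hb hu hv
  have hX0 : 0 < X := by linarith
  set s := Finset.Icc 1 K
  set t := Finset.Icc 1 L
  simp_rw [← Real.sqrt_eq_rpow]
  set B₁ := #{p ∈ s ×ˢ s | |u p.1 - u p.2| ≤ 1 / X}
  set B₂ := #{p ∈ t ×ˢ t | |v p.1 - v p.2| ≤ 1 / X}
  set Q : ℕ := ⌊(2 * W + 1) ^ 2 * X⌋₊ + 1 with hQ
  have hQ1 : (2 * W + 1) ^ 2 * X < Q := by
    rw [hQ]; push_cast; exact Nat.lt_floor_add_one _
  have hQ2 : (Q : ℝ) ≤ ((2 * W + 1) ^ 2 + 1) * X := by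
    have := Nat.floor_le (show 0 ≤ (2 * W + 1) ^ 2 * X by positivity)
    rw [hQ]; push_cast; linarith
  have hW0 : 0 < W := by positivity
  have hQX : X ≤ Q :=
    (le_mul_of_one_le_left hX0.le (one_le_pow₀ (by linarith))).trans hQ1.le
  have hQ0 : (0 : ℝ) < Q := by linarith
  set M := √(X * Q)
  have hMM : M * M = X * Q := Real.mul_self_sqrt (by positivity)
  have hXM : X ≤ M := Real.le_sqrt_of_sq_le (by nlinarith)
  have hM0 : 0 < M := by linarith
  have hWM : (2 * W + 1) * M < Q := by
    refine lt_of_pow_lt_pow_left₀ 2 hQ0.le ?_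
    nlinarith
  have hQU : 2 * U * M + 1 < Q := by nlinarith [mul_pos hV hM0]
  have hQV : 2 * V * M + 1 < Q := by nlinarith [mul_pos hU hM0]
  set i : ℕ → ℤ := fun k => ⌊M * u k⌋
  set j : ℕ → ℤ := fun l => ⌊M * v l⌋
  have base : ∀ (a b : ℕ → ℂ), (∀ k ∈ s, ‖a k‖ ≤ 1) → (∀ l ∈ t, ‖b l‖ ≤ 1) →
      ‖∑ k ∈ s, ∑ l ∈ t, a k * b l * ZMod.stdAddChar ((i k : ZMod Q) * (j l : ZMod Q))‖ ≤
        √(Q * B₁ * B₂) := by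
    intro a b ha hb
    refine Real.le_sqrt_of_sq_le ((norm_sum_stdAddChar_sq_le Q s t _ _ a b ha hb).trans ?_)
    gcongr
    · exact card_floor_congr_le s u U X M Q hX0 hXM hQU hu
    · exact card_floor_congr_le t v V X M Q hX0 hXM hQV hv
  have frac_nonneg (w : ℝ) : 0 ≤ w - ⌊M * w⌋ / M := by
    rw [sub_nonneg, div_le_iff₀ hM0, mul_comm]
    exact Int.floor_le _
  have frac_le (w : ℝ) : w - ⌊M * w⌋ / M ≤ 1 / M := by
    rw [sub_le_iff_le_add, ← add_div, le_div_iff₀ hM0]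
    linarith [Int.lt_floor_add_one (M * w)]
  have frac_norm (w : ℝ) : ‖((X * (w - ⌊M * w⌋ / M) : ℝ) : ℂ)‖ ≤ 1 := by
    rw [Complex.norm_real, Real.norm_of_nonneg (mul_nonneg hX0.le (frac_nonneg w))]
    calc _ ≤ X * (1 / M) := by gcongr; exact frac_le w
      _ ≤ 1 := by rw [mul_one_div]; exact div_le_one_of_le₀ hXM hM0.le
  have hx₁ : ∀ k ∈ s, ‖((i k / M / (U + 1) : ℝ) : ℂ)‖ ≤ 1 := by
    intro k hk
    have h1 := abs_le.1 (hu k hk)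
    have h2 := frac_nonneg (u k)
    have h3 := frac_le (u k)
    have h4 : 1 / M ≤ 1 := div_le_one_of_le₀ (hX.trans hXM) hM0.le
    rw [Complex.norm_real, Real.norm_eq_abs, abs_div, abs_of_pos (show 0 < U + 1 by positivity)]
    refine div_le_one_of_le₀ (abs_le.2 ⟨?_, ?_⟩) (by positivity) <;> linarith
  have hy₂ : ∀ l ∈ t, ‖((v l / V : ℝ) : ℂ)‖ ≤ 1 := by
    intro l hl
    rw [Complex.norm_real, Real.norm_eq_abs, abs_div, abs_of_pos hV]
    exact div_le_one_of_le₀ (hv l hl) hV.le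
  have main := norm_bilinear_mul_exp_le s t _ _
    (norm_bilinear_mul_exp_le s t _ _ base z₁ _
      (fun l => ((X * (v l - ⌊M * v l⌋ / M) : ℝ) : ℂ)) hx₁ fun l _ => frac_norm (v l))
    z₂ (fun k => ((X * (u k - ⌊M * u k⌋ / M) : ℝ) : ℂ)) _ (fun k _ => frac_norm (u k)) hy₂
    a b (fun k _ => ha k) fun l _ => hb l
  refine (le_of_eq (congrArg _ ?_)).trans (main.trans ?_)
  · refine sum_congr rfl fun k _ => sum_congr rfl fun l _ => congrArg _ ?_
    rw [← Int.cast_mul, ZMod.stdAddChar_coe, ← Complex.exp_add, ← Complex.exp_add]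
    congr 1
    have hU1 : ((U : ℂ) + 1) ≠ 0 := by exact_mod_cast (show U + 1 ≠ 0 by positivity)
    have hV1 : (V : ℂ) ≠ 0 := by exact_mod_cast hV.ne'
    have hM1 : (M : ℂ) ≠ 0 := by exact_mod_cast hM0.ne'
    have hQ1 : (Q : ℂ) ≠ 0 := by exact_mod_cast hQ0.ne'
    have hMQ : (1 : ℂ) / Q = X / (M * M) := by
      rw [div_eq_div_iff hQ1 (mul_ne_zero hM1 hM1)]
      have : (M : ℂ) * M = X * Q := by exact_mod_cast hMM
      rw [this, one_mul]
    rw [hz₁, hz₂, div_eq_mul_one_div _ (Q : ℂ), hMQ]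
    push_cast
    field_simp
    ring
  · simp only [mul_assoc]
    refine mul_le_mul_of_nonneg_left (mul_le_mul_of_nonneg_left ?_ (by positivity)) (by positivity)
    rw [← Real.sqrt_mul (by positivity), ← Real.sqrt_mul (by positivity),
      ← Real.sqrt_mul (by positivity)]
    refine Real.sqrt_le_sqrt ?_
    simp only [← mul_assoc]
    gcongr
end
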